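/- Let m ≥ 0 and ω_p = √(‖p‖² + m²). Then the thermometer function β ↦ (2π)⁻³ ∫_{ℝ³} ω_p⁻¹ (e^{βω_p} − 1)⁻¹ dp is strictly decreasing on (0, ∞) (with finite values). (The expectation value of the Wick square in the β-KMS state is a monotonously decreasing function of the inverse temperature β, which justifies interpreting the Wick square as a local thermometer observable.) -/

import Mathlib

open MeasureTheory Real

/-- Relativistic energy ω_p = √(‖p‖² + m²). -/
noncomputable def omega (m : ℝ) (p : EuclideanSpace ℝ (Fin 3)) : ℝ :=
  Real.sqrt (‖p‖ ^ 2 + m ^ 2)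

theorem mul_exp_half_le_exp_sub_one {x : ℝ} (hx : 0 ≤ x) :
    x * Real.exp (x / 2) ≤ Real.exp x - 1 := by
  have h : x / 2 ≤ Real.sinh (x / 2) := Real.self_le_sinh_iff.2 (by linarith)
  rw [Real.sinh_eq] at h
  have h1 : Real.exp (x / 2) * Real.exp (x / 2) = Real.exp x := by
    rw [← Real.exp_add]; ring_nf
  have h2 : Real.exp (-(x / 2)) * Real.exp (x / 2) = 1 := by
    rw [← Real.exp_add]; simp
  nlinarith [Real.exp_pos (x / 2)]

theorem omega_pos (m : ℝ) {p : EuclideanSpace ℝ (Fin 3)} (hp : p ≠ 0) : 0 < omega m p := by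
  have := norm_pos_iff.2 hp
  exact Real.sqrt_pos.2 (by positivity)

theorem integrableOn_planck_radial (m : ℝ) {β : ℝ} (hβ : 0 < β) :
    IntegrableOn (fun y : ℝ => y ^ 2 * ((Real.sqrt (y ^ 2 + m ^ 2))⁻¹ *
      (Real.exp (β * Real.sqrt (y ^ 2 + m ^ 2)) - 1)⁻¹)) (Set.Ioi 0) := by
  refine Integrable.mono'
    (g := fun y => β⁻¹ * Real.exp (-(β / 2) * y))
    ((exp_neg_integrableOn_Ioi 0 (half_pos hβ)).const_mul _)
    (by fun_prop) ?_
  filter_upwards [self_mem_ae_restrict measurableSet_Ioi] with y hy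
  have hy : 0 < y := hy
  set w := Real.sqrt (y ^ 2 + m ^ 2)
  have hw : y ≤ w := Real.le_sqrt_of_sq_le (by nlinarith [sq_nonneg m])
  have hw0 : 0 < w := hy.trans_le hw
  have he : β * y * Real.exp (β * y / 2) ≤ Real.exp (β * w) - 1 :=
    (mul_exp_half_le_exp_sub_one (by positivity)).trans (by gcongr)
  have hpos : 0 < β * y * Real.exp (β * y / 2) := by positivity
  have he0 : 0 < Real.exp (β * w) - 1 := hpos.trans_le he
  rw [Real.norm_of_nonneg (by positivity)]
  calc y ^ 2 * (w⁻¹ * (Real.exp (β * w) - 1)⁻¹)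
      ≤ y ^ 2 * (y⁻¹ * (β * y * Real.exp (β * y / 2))⁻¹) := by gcongr
    _ = β⁻¹ * Real.exp (-(β / 2) * y) := by
        rw [show -(β / 2) * y = -(β * y / 2) by ring, Real.exp_neg]
        field_simp

theorem integrable_planck (m : ℝ) {β : ℝ} (hβ : 0 < β) :
    Integrable (fun p : EuclideanSpace ℝ (Fin 3) =>
      (omega m p)⁻¹ * (Real.exp (β * omega m p) - 1)⁻¹) := by
  have h := integrable_fun_norm_addHaar (volume : Measure (EuclideanSpace ℝ (Fin 3)))
    (f := fun y : ℝ => (Real.sqrt (y ^ 2 + m ^ 2))⁻¹ *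
      (Real.exp (β * Real.sqrt (y ^ 2 + m ^ 2)) - 1)⁻¹)
  refine h.2 ?_
  simpa using integrableOn_planck_radial m hβ

theorem planck_lt {w a b : ℝ} (hw : 0 < w) (ha : 0 < a) (hab : a < b) :
    w⁻¹ * (Real.exp (b * w) - 1)⁻¹ < w⁻¹ * (Real.exp (a * w) - 1)⁻¹ := by
  have h1 : 0 < Real.exp (a * w) - 1 := sub_pos.2 (Real.one_lt_exp_iff.2 (by positivity))
  have h2 : Real.exp (a * w) < Real.exp (b * w) := Real.exp_lt_exp.2 (by gcongr)
  gcongr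

theorem integral_planck_lt (m : ℝ) {a b : ℝ} (ha : 0 < a) (hab : a < b) :
    ∫ p : EuclideanSpace ℝ (Fin 3), (omega m p)⁻¹ * (Real.exp (b * omega m p) - 1)⁻¹ <
      ∫ p : EuclideanSpace ℝ (Fin 3), (omega m p)⁻¹ * (Real.exp (a * omega m p) - 1)⁻¹ := by
  have hia := integrable_planck m ha
  have hib := integrable_planck m (ha.trans hab)
  rw [← sub_pos, ← integral_sub hia hib]
  have hlt : ∀ p : EuclideanSpace ℝ (Fin 3), p ≠ 0 →
      0 < (omega m p)⁻¹ * (Real.exp (a * omega m p) - 1)⁻¹ -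
        (omega m p)⁻¹ * (Real.exp (b * omega m p) - 1)⁻¹ :=
    fun p hp => sub_pos.2 (planck_lt (omega_pos m hp) ha hab)
  have hae : ∀ᵐ p : EuclideanSpace ℝ (Fin 3), p ≠ 0 := Measure.ae_ne volume 0
  refine (integral_pos_iff_support_of_nonneg_ae ?_ (hia.sub hib)).2 ?_
  · filter_upwards [hae] with p hp using (hlt p hp).le
  · refine lt_of_lt_of_le ?_ (measure_mono (s := {0}ᶜ) fun p hp => (hlt p hp).ne')
    exact isOpen_compl_singleton.measure_pos volume (exists_ne 0)

/-- The thermometer function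
    β ↦ (2π)⁻³ ∫_{ℝ³} ω_p⁻¹ (e^{βω_p} − 1)⁻¹ dp
    has finite values and is strictly decreasing on (0, ∞). -/
theorem thermometer_strictAnti (m : ℝ) (hm : 0 ≤ m) :
    (∀ β : ℝ, 0 < β →
      Integrable (fun p : EuclideanSpace ℝ (Fin 3) =>
        (omega m p)⁻¹ * (Real.exp (β * omega m p) - 1)⁻¹)) ∧
    StrictAntiOn (fun β : ℝ =>
        ((2 * Real.pi) ^ 3)⁻¹ *
          ∫ p : EuclideanSpace ℝ (Fin 3),
            (omega m p)⁻¹ * (Real.exp (β * omega m p) - 1)⁻¹)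
      (Set.Ioi 0) := by
  refine ⟨fun β hβ => integrable_planck m hβ, fun a ha b _ hab => ?_⟩
  exact mul_lt_mul_of_pos_left (integral_planck_lt m ha hab) (by positivity)
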